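/- With the same bilateral measurement channel Φ as above (ρ' = ((2+√(1-γ₁²))/4)ρ + (1/4)(I⊗σ₁)ρ(I⊗σ₁) + ((1-√(1-γ₁²))/4)(I⊗σ₃)ρ(I⊗σ₃), and Φ(ρ) = (1/2)ρ' + (cos²θ/2)(σ₁⊗I)ρ'(σ₁⊗I) + (sin²θ/2)(σ₃⊗I)ρ'(σ₃⊗I)), we have Tr[Φ(ρ)(σ₃⊗σ₃)] = (1/2)·sin²(θ)·Tr[ρ(σ₃⊗σ₃)]. -/

import Mathlib

open Real Matrix
open scoped Kronecker

noncomputable def σ₁ : Matrix (Fin 2) (Fin 2) ℂ := !![0, 1; 1, 0]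
noncomputable def σ₃ : Matrix (Fin 2) (Fin 2) ℂ := !![1, 0; 0, -1]

theorem Matrix.trace_conj_mul_of_conj_eq_smul {n : Type*} [Fintype n]
    {A B : Matrix n n ℂ} {c : ℂ} (h : A * B * A = c • B) (M : Matrix n n ℂ) :
    (A * M * A * B).trace = c * (M * B).trace := by
  rw [Matrix.mul_assoc, Matrix.mul_assoc, trace_mul_comm, Matrix.mul_assoc, h,
    Matrix.mul_smul, trace_smul, smul_eq_mul]

theorem σ₁_mul_σ₃_mul_σ₁ : σ₁ * σ₃ * σ₁ = (-1 : ℂ) • σ₃ := by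
  ext i j
  fin_cases i <;> fin_cases j <;> simp [σ₁, σ₃]

theorem σ₃_mul_σ₃_mul_σ₃ : σ₃ * σ₃ * σ₃ = (1 : ℂ) • σ₃ := by
  ext i j
  fin_cases i <;> fin_cases j <;> simp [σ₃]

theorem Matrix.one_kronecker_conj {P Q : Matrix (Fin 2) (Fin 2) ℂ} {c : ℂ}
    (h : P * Q * P = c • Q) (R : Matrix (Fin 2) (Fin 2) ℂ) :
    (1 ⊗ₖ P) * (R ⊗ₖ Q) * (1 ⊗ₖ P) = c • (R ⊗ₖ Q) := by
  rw [← mul_kronecker_mul, ← mul_kronecker_mul, h, kronecker_smul, Matrix.one_mul, Matrix.mul_one]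

theorem Matrix.kronecker_one_conj {P Q : Matrix (Fin 2) (Fin 2) ℂ} {c : ℂ}
    (h : P * Q * P = c • Q) (R : Matrix (Fin 2) (Fin 2) ℂ) :
    (P ⊗ₖ 1) * (Q ⊗ₖ R) * (P ⊗ₖ 1) = c • (Q ⊗ₖ R) := by
  rw [← mul_kronecker_mul, ← mul_kronecker_mul, h, smul_kronecker, Matrix.one_mul, Matrix.mul_one]

theorem stmt_6 (ρ : Matrix (Fin 2 × Fin 2) (Fin 2 × Fin 2) ℂ) (hρ : ρ.IsHermitian)
    (γ₁ θ : ℝ) (hγ1 : 0 ≤ γ₁) (hγ2 : γ₁ ≤ 1) :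
    let s : ℝ := Real.sqrt (1 - γ₁ ^ 2)
    let ρ' : Matrix (Fin 2 × Fin 2) (Fin 2 × Fin 2) ℂ :=
      (((2 + s) / 4 : ℝ) : ℂ) • ρ
        + ((1 / 4 : ℝ) : ℂ) • ((1 ⊗ₖ σ₁) * ρ * (1 ⊗ₖ σ₁))
        + (((1 - s) / 4 : ℝ) : ℂ) • ((1 ⊗ₖ σ₃) * ρ * (1 ⊗ₖ σ₃))
    let Φρ : Matrix (Fin 2 × Fin 2) (Fin 2 × Fin 2) ℂ :=
      ((1 / 2 : ℝ) : ℂ) • ρ'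
        + ((cos θ ^ 2 / 2 : ℝ) : ℂ) • ((σ₁ ⊗ₖ 1) * ρ' * (σ₁ ⊗ₖ 1))
        + ((sin θ ^ 2 / 2 : ℝ) : ℂ) • ((σ₃ ⊗ₖ 1) * ρ' * (σ₃ ⊗ₖ 1))
    (Φρ * (σ₃ ⊗ₖ σ₃)).trace
      = ((1 / 2 * sin θ ^ 2 : ℝ) : ℂ) * (ρ * (σ₃ ⊗ₖ σ₃)).trace := by
  intro s ρ' Φρ
  have hρ' : (ρ' * (σ₃ ⊗ₖ σ₃)).trace = (1 / 2) * (ρ * (σ₃ ⊗ₖ σ₃)).trace := by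
    simp only [ρ', Matrix.add_mul, Matrix.smul_mul, trace_add, trace_smul, smul_eq_mul,
      trace_conj_mul_of_conj_eq_smul (one_kronecker_conj σ₁_mul_σ₃_mul_σ₁ σ₃),
      trace_conj_mul_of_conj_eq_smul (one_kronecker_conj σ₃_mul_σ₃_mul_σ₃ σ₃)]
    push_cast
    ring
  simp only [Φρ, Matrix.add_mul, Matrix.smul_mul, trace_add, trace_smul, smul_eq_mul,
    trace_conj_mul_of_conj_eq_smul (kronecker_one_conj σ₁_mul_σ₃_mul_σ₁ σ₃),
    trace_conj_mul_of_conj_eq_smul (kronecker_one_conj σ₃_mul_σ₃_mul_σ₃ σ₃), hρ', cos_sq']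
  push_cast
  ring
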